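/- arXiv:0802.3839 — 4 statements merged into one kernel-verified Lean document; each statement's English description precedes it below -/
import Mathlib

section
/- Let F be the free group on two generators a, b, and write [x,y] = x⁻¹y⁻¹xy. Fix positive integers k, N, B and a k-tuple of positive integers (n₁,…,n_k). Then there exist elements z₁,…,z_k ∈ F with ∏_{j=1}^{k} z_j⁻¹ [a, b^{n_j}] z_j = [a^N, b^B] if and only if there is a function S : {1,…,k} → {1,…,N} such that for every i ∈ {1,…,N} one has ∑_{j : S(j)=i} n_j = B (i.e. the multiset {n₁,…,n_k} can be partitioned into N groups each summing to B). -/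
/-- The first generator `a` of the free group on two generators. -/
def fgA : FreeGroup (Fin 2) := FreeGroup.of 0

/-- The second generator `b` of the free group on two generators. -/
def fgB : FreeGroup (Fin 2) := FreeGroup.of 1

/-- The commutator with the convention `[x,y] = x⁻¹ y⁻¹ x y`. -/
def fgComm (x y : FreeGroup (Fin 2)) : FreeGroup (Fin 2) := x⁻¹ * y⁻¹ * x * y

section ConjProd

variable {ι G : Type*} [Group G]

/-- `ConjProd x s g` says that `g` is a product, in some order, of conjugates of the elements
`x i` for `i` in the multiset `s`. -/
inductive ConjProd (x : ι → G) : Multiset ι → G → Prop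
  | zero : ConjProd x 0 1
  | cons (i : ι) (z : G) {s : Multiset ι} {g : G} :
      ConjProd x s g → ConjProd x (i ::ₘ s) (z⁻¹ * x i * z * g)

namespace ConjProd

variable {x : ι → G} {s t : Multiset ι} {g h : G}

theorem add (hg : ConjProd x s g) (hh : ConjProd x t h) : ConjProd x (s + t) (g * h) := by
  induction hg with
  | zero => simpa using hh
  | cons i z _ ih =>
    rw [Multiset.cons_add, mul_assoc]
    exact ih.cons i z

theorem conj (hg : ConjProd x s g) (w : G) : ConjProd x s (w⁻¹ * g * w) := by
  induction hg with
  | zero => simpa using ConjProd.zero (x := x)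
  | cons i z _ ih =>
    convert ih.cons i (z * w) using 1
    group

theorem singleton (x : ι → G) (i : ι) : ConjProd x {i} (x i) := by
  simpa using (ConjProd.zero (x := x)).cons i 1

/-- Any of the factors can be brought to the front. -/
theorem exists_of_cons {i : ι} (hg : ConjProd x (i ::ₘ s) g) :
    ∃ z h, ConjProd x s h ∧ g = z⁻¹ * x i * z * h := by
  generalize hu : i ::ₘ s = u at hg
  induction hg generalizing s with
  | zero => simp at hu
  | @cons j z v g hv ih =>
    rcases Multiset.cons_eq_cons.1 hu with ⟨rfl, rfl⟩ | ⟨-, u, rfl, rfl⟩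
    · exact ⟨z, g, hv, rfl⟩
    · obtain ⟨w, h, hh, rfl⟩ := ih rfl
      refine ⟨w, _, hh.cons j (z * (w⁻¹ * x i * w)), ?_⟩
      group

theorem exists_list_prod_eq {l : List ι} (hl : l.Nodup) (hg : ConjProd x (l : Multiset ι) g) :
    ∃ z : ι → G, (l.map fun i => (z i)⁻¹ * x i * z i).prod = g := by
  classical
  induction l generalizing g with
  | nil =>
    generalize hu : (([] : List ι) : Multiset ι) = u at hg
    cases hg with
    | zero => exact ⟨1, rfl⟩
    | cons => simp at hu
  | cons i l ih =>
    obtain ⟨w, h, hh, rfl⟩ := exists_of_cons (s := (l : Multiset ι)) hg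
    rw [List.nodup_cons] at hl
    obtain ⟨z, rfl⟩ := ih hl.2 hh
    refine ⟨Function.update z i w, ?_⟩
    rw [List.map_cons, List.prod_cons, Function.update_self]
    congr 2
    refine List.map_congr_left fun j hj => ?_
    rw [Function.update_of_ne (ne_of_mem_of_not_mem hj hl.1)]

end ConjProd

end ConjProd

theorem fgComm_mul_left (x y z : FreeGroup (Fin 2)) :
    fgComm (x * y) z = y⁻¹ * fgComm x z * y * fgComm y z := by
  simp only [fgComm]
  group

theorem fgComm_mul_right (x y z : FreeGroup (Fin 2)) :
    fgComm x (y * z) = fgComm x z * (z⁻¹ * fgComm x y * z) := by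
  simp only [fgComm]
  group

theorem conjProd_fgComm_pow_sum {ι : Type*} (x y : FreeGroup (Fin 2)) (n : ι → ℕ)
    (s : Finset ι) :
    ConjProd (fun j => fgComm x (y ^ n j)) s.val (fgComm x (y ^ ∑ j ∈ s, n j)) := by
  classical
  induction s using Finset.induction_on with
  | empty => simpa [fgComm] using ConjProd.zero
  | insert i s hi ih =>
    rw [Finset.sum_insert hi, pow_add, fgComm_mul_right, Finset.insert_val_of_notMem hi,
      ← Multiset.singleton_add, add_comm]
    exact ih.add ((ConjProd.singleton (fun j => fgComm x (y ^ n j)) i).conj _)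

theorem conjProd_fgComm_of_bins {ι κ : Type*} [Fintype ι] [DecidableEq κ]
    (x y : FreeGroup (Fin 2)) (n : ι → ℕ) (B : ℕ) (S : ι → κ)
    (hS : ∀ i, ∑ j ∈ Finset.univ.filter (fun j => S j = i), n j = B) (t : Finset κ) :
    ConjProd (fun j => fgComm x (y ^ n j)) (Finset.univ.filter (fun j => S j ∈ t)).val
      (fgComm (x ^ t.card) (y ^ B)) := by
  induction t using Finset.induction_on with
  | empty => simpa [fgComm] using ConjProd.zero
  | insert i t hi ih =>
    have hd : Disjoint (Finset.univ.filter fun j => S j ∈ t)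
        (Finset.univ.filter fun j => S j = i) := by
      rw [Finset.disjoint_filter]
      rintro j - hj rfl
      exact hi hj
    have hu : (Finset.univ.filter fun j => S j ∈ insert i t) =
        (Finset.univ.filter fun j => S j ∈ t).disjUnion
          (Finset.univ.filter fun j => S j = i) hd := by
      ext j
      simp [or_comm]
    rw [hu, Finset.card_insert_of_notMem hi, pow_succ, fgComm_mul_left]
    have hc := conjProd_fgComm_pow_sum x y n (Finset.univ.filter fun j => S j = i)
    rw [hS] at hc
    exact (ih.conj x).add hc

section Affine

open LaurentPolynomial

/-- The action of the free group on Laurent polynomials in which `a` acts as multiplication by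
`T⁻¹` and `b` as translation by `1`. -/
noncomputable def affineRep : FreeGroup (Fin 2) →* Equiv.Perm ℤ[T;T⁻¹] :=
  FreeGroup.lift ![⟨fun r => T (-1) * r, fun r => T 1 * r,
    fun r => by simp only [← mul_assoc, ← T_add]; simp,
    fun r => by simp only [← mul_assoc, ← T_add]; simp⟩,
    Equiv.addRight 1]

theorem affineRep_fgA (r : ℤ[T;T⁻¹]) : affineRep fgA r = T (-1) * r := by
  simp [affineRep, fgA]

theorem affineRep_fgB (r : ℤ[T;T⁻¹]) : affineRep fgB r = r + 1 := by
  simp [affineRep, fgB]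

theorem affineRep_fgA_pow (m : ℕ) (r : ℤ[T;T⁻¹]) :
    affineRep (fgA ^ m) r = T (-m) * r := by
  induction m generalizing r with
  | zero => simp
  | succ m ih =>
    rw [pow_succ, map_mul, Equiv.Perm.mul_apply, ih, affineRep_fgA, ← mul_assoc, ← T_add]
    congr 2
    push_cast
    ring

theorem affineRep_fgB_pow (m : ℕ) (r : ℤ[T;T⁻¹]) : affineRep (fgB ^ m) r = r + m := by
  induction m generalizing r with
  | zero => simp
  | succ m ih =>
    rw [pow_succ, map_mul, Equiv.Perm.mul_apply, ih, affineRep_fgB]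
    push_cast
    ring

theorem affineRep_inv_apply_eq {g : FreeGroup (Fin 2)} {r q : ℤ[T;T⁻¹]} :
    affineRep g⁻¹ r = q ↔ r = affineRep g q := by
  rw [map_inv, Equiv.Perm.inv_eq_iff_eq]

theorem affineRep_fgComm (m l : ℕ) (r : ℤ[T;T⁻¹]) :
    affineRep (fgComm (fgA ^ m) (fgB ^ l)) r =
      r + (l : ℤ[T;T⁻¹]) * (1 - T m) := by
  have h : (T (-m) * T m : ℤ[T;T⁻¹]) = 1 := by rw [← T_add]; simp
  rw [fgComm, mul_assoc, mul_assoc, map_mul, Equiv.Perm.mul_apply, affineRep_inv_apply_eq,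
    map_mul, Equiv.Perm.mul_apply, affineRep_inv_apply_eq, map_mul, Equiv.Perm.mul_apply,
    affineRep_fgB_pow, affineRep_fgB_pow, affineRep_fgA_pow, affineRep_fgA_pow]
  linear_combination (l : ℤ[T;T⁻¹]) * h

theorem exists_affineRep_apply_eq (z : FreeGroup (Fin 2)) :
    ∃ (e : ℤ) (c : ℤ[T;T⁻¹]), ∀ r, affineRep z r = T e * r + c := by
  have inv {g : FreeGroup (Fin 2)}
      (hg : ∃ (e : ℤ) (c : ℤ[T;T⁻¹]), ∀ r, affineRep g r = T e * r + c) :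
      ∃ (e : ℤ) (c : ℤ[T;T⁻¹]), ∀ r, affineRep g⁻¹ r = T e * r + c := by
    obtain ⟨e, c, h⟩ := hg
    have hT : (T e * T (-e) : ℤ[T;T⁻¹]) = 1 := by rw [← T_add]; simp
    refine ⟨-e, -(T (-e) * c), fun r => ?_⟩
    rw [affineRep_inv_apply_eq, h]
    linear_combination (c - r) * hT
  have of (i : Fin 2) :
      ∃ (e : ℤ) (c : ℤ[T;T⁻¹]), ∀ r, affineRep (FreeGroup.of i) r = T e * r + c := by
    fin_cases i
    · exact ⟨-1, 0, fun r => (affineRep_fgA r).trans (add_zero _).symm⟩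
    · exact ⟨0, 1, fun r => by rw [T_zero, one_mul]; exact affineRep_fgB r⟩
  induction z using FreeGroup.induction_on with
  | C1 => exact ⟨0, 0, fun r => by simp⟩
  | of i => exact of i
  | inv_of i _ => exact inv (of i)
  | mul g h hg hh =>
    obtain ⟨e, c, h₁⟩ := hg
    obtain ⟨f, d, h₂⟩ := hh
    refine ⟨e + f, T e * d + c, fun r => ?_⟩
    rw [map_mul, Equiv.Perm.mul_apply, h₂, h₁, T_add]
    ring

/-- Conjugating a translation multiplies its displacement by a power of `T`. -/
theorem exists_affineRep_conj_apply_eq (z : FreeGroup (Fin 2)) :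
    ∃ e : ℤ, ∀ (g : FreeGroup (Fin 2)) (t : ℤ[T;T⁻¹]), (∀ r, affineRep g r = r + t) →
      ∀ r, affineRep (z⁻¹ * g * z) r = r + T e * t := by
  obtain ⟨e, c, h⟩ := exists_affineRep_apply_eq z
  have hT : (T e * T (-e) : ℤ[T;T⁻¹]) = 1 := by rw [← T_add]; simp
  refine ⟨-e, fun g t hg r => ?_⟩
  rw [mul_assoc, map_mul, Equiv.Perm.mul_apply, affineRep_inv_apply_eq, map_mul,
    Equiv.Perm.mul_apply, hg, h, h]
  linear_combination -t * hT

theorem affineRep_list_prod {ι : Type*} (g : ι → FreeGroup (Fin 2)) (t : ι → ℤ[T;T⁻¹])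
    (h : ∀ i r, affineRep (g i) r = r + t i) (l : List ι) (r : ℤ[T;T⁻¹]) :
    affineRep (l.map g).prod r = r + (l.map t).sum := by
  induction l with
  | nil => simp
  | cons i l ih =>
    rw [List.map_cons, List.prod_cons, map_mul, Equiv.Perm.mul_apply, ih, h, List.map_cons,
      List.sum_cons]
    ring

/-- If the product of conjugates of `[a, b ^ n j]` equals `[a ^ N, b ^ B]`, then the `j`-th
conjugator determines a column `e j`, and each of the columns `0, …, N - 1` has total `B`, every
other column having total `0`. -/
theorem exists_column_sums_of_prod_conj_eq {k N B : ℕ} {n : Fin k → ℕ}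
    {z : Fin k → FreeGroup (Fin 2)}
    (hz : (List.ofFn fun j => (z j)⁻¹ * fgComm fgA (fgB ^ n j) * z j).prod =
      fgComm (fgA ^ N) (fgB ^ B)) :
    ∃ e : Fin k → ℤ, ∀ m : ℤ, (∑ j ∈ Finset.univ.filter (fun j => e j = m), (n j : ℤ)) =
      ∑ i ∈ Finset.range N, if (i : ℤ) = m then (B : ℤ) else 0 := by
  choose e he using fun j => exists_affineRep_conj_apply_eq (z j)
  refine ⟨e, fun m => ?_⟩
  have hj (j : Fin k) (r : ℤ[T;T⁻¹]) :
      affineRep ((z j)⁻¹ * fgComm fgA (fgB ^ n j) * z j) r =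
        r + T (e j) * ((n j : ℤ[T;T⁻¹]) * (1 - T 1)) :=
    he j _ _ (fun r => by simpa using affineRep_fgComm 1 (n j) r) r
  have h0 := affineRep_fgComm N B 0
  rw [← hz, List.ofFn_eq_map, affineRep_list_prod _ _ hj, ← List.ofFn_eq_map, List.sum_ofFn,
    zero_add, zero_add] at h0
  have hT : (1 - T 1 : ℤ[T;T⁻¹]) ≠ 0 := by
    rw [← T_zero]
    intro h
    simpa [-T_zero] using congrArg (fun p : ℤ[T;T⁻¹] => p.coeff 1) h
  have hgeom := geom_sum_mul_neg (T 1 : ℤ[T;T⁻¹]) N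
  have key : ∑ j, (n j : ℤ) • (T (e j) : ℤ[T;T⁻¹]) =
      ∑ i ∈ Finset.range N, (B : ℤ) • (T i : ℤ[T;T⁻¹]) := by
    apply mul_right_cancel₀ hT
    calc _ = ∑ j, T (e j) * ((n j : ℤ[T;T⁻¹]) * (1 - T 1)) := by
          rw [Finset.sum_mul]
          exact Finset.sum_congr rfl fun j _ => by simp; ring
      _ = _ := by
          rw [h0, ← Finset.smul_sum]
          simp only [T_pow, mul_one] at hgeom
          rw [smul_mul_assoc, hgeom]
          simp
  have hm := congrArg (fun p : ℤ[T;T⁻¹] => p.coeff m) key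
  simpa [Finset.sum_filter, -zsmul_eq_mul, -natCast_zsmul] using hm

end Affine

/-- The quadratic equation `∏ zⱼ⁻¹ [a, b^{nⱼ}] zⱼ = [a^N, b^B]` has a solution in the
free group on `a, b` iff `(n₁, …, n_k)` can be partitioned into `N` bins, each of sum `B`. -/
theorem quad_eq_solvable_iff_exact_bin_packing
    (k N B : ℕ) (hk : 0 < k) (hN : 0 < N) (hB : 0 < B)
    (n : Fin k → ℕ) (hn : ∀ j, 0 < n j) :
    (∃ z : Fin k → FreeGroup (Fin 2),
        (List.ofFn (fun j : Fin k => (z j)⁻¹ * fgComm fgA (fgB ^ n j) * z j)).prod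
          = fgComm (fgA ^ N) (fgB ^ B)) ↔
      (∃ S : Fin k → Fin N, ∀ i : Fin N,
        ∑ j ∈ Finset.univ.filter (fun j => S j = i), n j = B) := by
  constructor
  · rintro ⟨z, hz⟩
    obtain ⟨e, he⟩ := exists_column_sums_of_prod_conj_eq hz
    have hcol (j : Fin k) : ∃ i : Fin N, (i : ℤ) = e j := by
      by_contra! hne
      have hpos : 0 < ∑ l ∈ Finset.univ.filter (fun l => e l = e j), (n l : ℤ) :=
        Finset.sum_pos (fun l _ => by exact_mod_cast hn l) ⟨j, by simp⟩
      rw [he, Finset.sum_eq_zero] at hpos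
      · exact hpos.false
      · intro i hi
        exact if_neg (hne ⟨i, Finset.mem_range.1 hi⟩)
    choose S hS using hcol
    refine ⟨S, fun i => ?_⟩
    have hi := he i
    simp only [← hS, Nat.cast_inj, Fin.val_inj] at hi
    rw [Finset.sum_ite_eq' _ (i : ℕ), if_pos (Finset.mem_range.2 i.2)] at hi
    exact_mod_cast hi
  · rintro ⟨S, hS⟩
    have h := conjProd_fgComm_of_bins fgA fgB n B S hS Finset.univ
    simp only [Finset.mem_univ, Finset.filter_true, Finset.card_univ, Fintype.card_fin] at h
    obtain ⟨z, hz⟩ := ConjProd.exists_list_prod_eq (List.nodup_finRange k) h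
    exact ⟨z, by rw [List.ofFn_eq_map, hz]⟩
end

section
/- Let F be the free group on two generators a, b, and write [x,y] = x⁻¹y⁻¹xy. Fix positive integers k, N, B and positive integers n₁,…,n_k. If there is a function S : {1,…,k} → {1,…,N} such that for every i, ∑_{j : S(j)=i} n_j = B, then there exist z₁,…,z_k ∈ F with ∏_{j=1}^{k} z_j⁻¹ [a, b^{n_j}] z_j = [a^N, b^B]. -/
/-- `g` is a product, in some order, of conjugates of the members of the multiset. -/
inductive IsProdOfConj {G : Type*} [Group G] : Multiset G → G → Prop
  | zero : IsProdOfConj 0 1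
  | cons (x z : G) {s : Multiset G} {g : G} (h : IsProdOfConj s g) :
      IsProdOfConj (x ::ₘ s) (z⁻¹ * x * z * g)

namespace IsProdOfConj

variable {G : Type*} [Group G]

theorem conj {s : Multiset G} {g : G} (h : IsProdOfConj s g) (w : G) :
    IsProdOfConj s (w⁻¹ * g * w) := by
  induction h with
  | zero => simpa using zero
  | cons x z _ ih =>
    convert cons x (z * w) ih using 1
    group

theorem add {s t : Multiset G} {g h : G} (hs : IsProdOfConj s g) (ht : IsProdOfConj t h) :
    IsProdOfConj (s + t) (g * h) := by
  induction hs with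
  | zero => simpa using ht
  | cons x z _ ih =>
    rw [Multiset.cons_add, mul_assoc]
    exact cons x z ih

/-- Any member of the multiset may be moved to the front of the product. -/
theorem exists_of_mem {s : Multiset G} {g : G} (h : IsProdOfConj s g) :
    ∀ {x : G} {t : Multiset G}, s = x ::ₘ t →
      ∃ z g', IsProdOfConj t g' ∧ g = z⁻¹ * x * z * g' := by
  induction h with
  | zero => intro x t hst; exact absurd hst.symm (Multiset.cons_ne_zero)
  | @cons y w s g hs ih =>
    intro x t hst
    rcases Multiset.cons_eq_cons.1 hst with ⟨rfl, rfl⟩ | ⟨_, u, hu, rfl⟩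
    · exact ⟨w, g, hs, rfl⟩
    · obtain ⟨z, g', hg', rfl⟩ := ih hu
      refine ⟨z * (w⁻¹ * y * w)⁻¹, _, cons y w hg', ?_⟩
      group

/-- The conjugates may be multiplied in any prescribed order. -/
theorem exists_ofFn_prod_eq {k : ℕ} {f : Fin k → G} {g : G}
    (h : IsProdOfConj (List.ofFn f : Multiset G) g) :
    ∃ z : Fin k → G, (List.ofFn fun j => (z j)⁻¹ * f j * z j).prod = g := by
  induction k generalizing g with
  | zero =>
    refine ⟨Fin.elim0, ?_⟩
    rw [List.ofFn_zero] at h ⊢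
    generalize hs : (([] : List G) : Multiset G) = s at h
    cases h with
    | zero => rfl
    | cons => exact absurd hs.symm Multiset.cons_ne_zero
  | succ k ih =>
    rw [List.ofFn_succ, ← Multiset.cons_coe] at h
    obtain ⟨z, g', hg', rfl⟩ := h.exists_of_mem rfl
    obtain ⟨y, rfl⟩ := ih hg'
    exact ⟨Fin.cons z y, by simp [List.ofFn_succ]⟩

end IsProdOfConj

theorem fgComm_pow_add (x y : FreeGroup (Fin 2)) (m l : ℕ) :
    fgComm x (y ^ (m + l)) =
      fgComm x (y ^ m) * ((y ^ m)⁻¹ * fgComm x (y ^ l) * y ^ m) := by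
  rw [add_comm, pow_add, fgComm, fgComm, fgComm]
  group

theorem fgComm_pow_succ (x y : FreeGroup (Fin 2)) (m : ℕ) :
    fgComm (x ^ (m + 1)) y = (x ^ m)⁻¹ * fgComm x y * x ^ m * fgComm (x ^ m) y := by
  rw [pow_succ', fgComm, fgComm, fgComm]
  group

theorem isProdOfConj_fgComm_pow_sum {ι : Type*} (x y : FreeGroup (Fin 2)) (n : ι → ℕ)
    (T : Finset ι) :
    IsProdOfConj (T.val.map fun j => fgComm x (y ^ n j)) (fgComm x (y ^ ∑ j ∈ T, n j)) := by
  classical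
  induction T using Finset.induction_on with
  | empty => simpa [fgComm] using IsProdOfConj.zero
  | insert i T hi ih =>
    rw [Finset.sum_insert hi, Finset.insert_val_of_notMem hi, Multiset.map_cons, fgComm_pow_add]
    simpa using IsProdOfConj.cons _ 1 (ih.conj (y ^ n i))

theorem isProdOfConj_fgComm_pow_card {ι κ : Type*} [Fintype ι] [DecidableEq κ]
    (x y : FreeGroup (Fin 2)) (n : ι → ℕ) (S : ι → κ) (B : ℕ)
    (hS : ∀ i, ∑ j ∈ Finset.univ.filter (fun j => S j = i), n j = B) (T : Finset κ) :
    IsProdOfConj ((Finset.univ.filter fun j => S j ∈ T).val.map fun j => fgComm x (y ^ n j))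
      (fgComm (x ^ T.card) (y ^ B)) := by
  induction T using Finset.induction_on with
  | empty => simpa [fgComm] using IsProdOfConj.zero
  | insert i T hi ih =>
    have hdisj : Disjoint (Finset.univ.filter fun j => S j = i)
        (Finset.univ.filter fun j => S j ∈ T) := by
      rw [Finset.disjoint_filter]
      rintro j - rfl
      exact hi
    have hunion : (Finset.univ.filter fun j => S j ∈ insert i T) =
        (Finset.univ.filter fun j => S j = i).disjUnion
          (Finset.univ.filter fun j => S j ∈ T) hdisj := by
      ext j
      simp
    rw [Finset.card_insert_of_notMem hi, fgComm_pow_succ, hunion, Finset.disjUnion_val,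
      Multiset.map_add]
    refine IsProdOfConj.add (IsProdOfConj.conj ?_ _) ih
    simpa only [hS] using
      isProdOfConj_fgComm_pow_sum x y n (Finset.univ.filter fun j => S j = i)

/-- If `(n₁, …, n_k)` can be partitioned into `N` bins each of sum `B`, then the quadratic
equation `∏ zⱼ⁻¹ [a, b^{nⱼ}] zⱼ = [a^N, b^B]` has a solution in the free group on `a, b`. -/
theorem exact_bin_packing_implies_quad_eq_solvable
    (k N B : ℕ) (hk : 0 < k) (hN : 0 < N) (hB : 0 < B)
    (n : Fin k → ℕ) (hn : ∀ j, 0 < n j)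
    (S : Fin k → Fin N)
    (hS : ∀ i : Fin N, ∑ j ∈ Finset.univ.filter (fun j => S j = i), n j = B) :
    ∃ z : Fin k → FreeGroup (Fin 2),
      (List.ofFn (fun j : Fin k => (z j)⁻¹ * fgComm fgA (fgB ^ n j) * z j)).prod
        = fgComm (fgA ^ N) (fgB ^ B) := by
  apply IsProdOfConj.exists_ofFn_prod_eq
  have h := isProdOfConj_fgComm_pow_card fgA fgB n S B hS Finset.univ
  rw [Finset.card_fin] at h
  simpa [List.ofFn_eq_map, Fin.univ_val_map] using h
end

section
/- Let F be the free group on two generators a, b, and write [x,y] = x⁻¹y⁻¹xy. Fix positive integers k, N, B and positive integers n₁,…,n_k. If there exist z₁,…,z_k ∈ F with ∏_{j=1}^{k} z_j⁻¹ [a, b^{n_j}] z_j = [a^N, b^B], then there is a function S : {1,…,k} → {1,…,N} such that for every i ∈ {1,…,N}, ∑_{j : S(j)=i} n_j = B. -/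
/-- The shift `f ↦ f (· + 1)` on integer sequences. -/
def seqShift : Equiv.Perm (ℤ → ℤ) :=
  Equiv.arrowCongr (Equiv.addRight (-1)) (Equiv.refl ℤ)

/-- The translation of integer sequences by the indicator function of the nonnegative integers. -/
def seqTranslate : Equiv.Perm (ℤ → ℤ) :=
  Equiv.addRight fun i => if 0 ≤ i then 1 else 0

/-- The affine action of the free group on integer sequences in which `a` shifts and `b`
translates by the indicator function of the nonnegative integers. -/
def seqAction : FreeGroup (Fin 2) →* Equiv.Perm (ℤ → ℤ) :=
  FreeGroup.lift ![seqShift, seqTranslate]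

@[simp] lemma seqAction_fgA : seqAction fgA = seqShift := by simp [seqAction, fgA]

@[simp] lemma seqAction_fgB : seqAction fgB = seqTranslate := by simp [seqAction, fgB]

lemma seqShift_apply (f : ℤ → ℤ) (i : ℤ) : seqShift f i = f (i + 1) := by
  simp [seqShift, Equiv.arrowCongr]

lemma seqTranslate_apply (f : ℤ → ℤ) (i : ℤ) :
    seqTranslate f i = f i + if 0 ≤ i then 1 else 0 := rfl

lemma seqShift_pow_apply (m : ℕ) (f : ℤ → ℤ) (i : ℤ) : (seqShift ^ m) f i = f (i + m) := by
  induction m generalizing f with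
  | zero => simp
  | succ m ih =>
    rw [pow_succ, Equiv.Perm.mul_apply, ih, seqShift_apply]
    push_cast
    rw [add_assoc]

lemma seqTranslate_pow_apply (m : ℕ) (f : ℤ → ℤ) (i : ℤ) :
    (seqTranslate ^ m) f i = f i + if 0 ≤ i then (m : ℤ) else 0 := by
  induction m generalizing f with
  | zero => simp
  | succ m ih =>
    rw [pow_succ, Equiv.Perm.mul_apply, ih, seqTranslate_apply]
    split_ifs <;> push_cast <;> ring

/-- The commutator `[a^M, b^m]` translates by `m` times the indicator function of `[0, M)`. -/
lemma seqAction_fgComm (M m : ℕ) (f : ℤ → ℤ) :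
    seqAction (fgComm (fgA ^ M) (fgB ^ m)) f =
      f + fun i : ℤ => if 0 ≤ i ∧ i < M then (m : ℤ) else 0 := by
  simp only [fgComm, map_mul, map_inv, map_pow, seqAction_fgA, seqAction_fgB,
    Equiv.Perm.mul_apply]
  rw [Equiv.Perm.inv_eq_iff_eq, Equiv.Perm.inv_eq_iff_eq]
  funext i
  simp only [seqShift_pow_apply, seqTranslate_pow_apply, Pi.add_apply]
  split_ifs <;> omega

/-- The linear part of every element of the free group is a shift. -/
lemma exists_seqAction_add (w : FreeGroup (Fin 2)) :
    ∃ e : ℤ, ∀ f u : ℤ → ℤ, seqAction w (f + u) = seqAction w f + fun i => u (i + e) := by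
  induction w using FreeGroup.induction_on with
  | C1 => exact ⟨0, by simp⟩
  | of x =>
    fin_cases x
    · refine ⟨1, fun f u => ?_⟩
      change seqAction fgA _ = seqAction fgA _ + _
      funext i
      simp [seqShift_apply]
    · refine ⟨0, fun f u => ?_⟩
      change seqAction fgB _ = seqAction fgB _ + _
      funext i
      simp [seqTranslate_apply, add_right_comm]
  | inv_of x hx =>
    obtain ⟨e, he⟩ := hx
    refine ⟨-e, fun f u => ?_⟩
    rw [map_inv, Equiv.Perm.inv_eq_iff_eq]
    simp [he]
  | mul x y hx hy =>
    obtain ⟨e, he⟩ := hx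
    obtain ⟨d, hd⟩ := hy
    refine ⟨e + d, fun f u => ?_⟩
    simp [map_mul, hd, he, add_assoc]

/-- A conjugate of `[a, b^m]` translates by `m` times the indicator function of a point. -/
lemma exists_seqAction_conj_fgComm (w : FreeGroup (Fin 2)) :
    ∃ e : ℤ, ∀ (m : ℕ) (f : ℤ → ℤ), seqAction (w⁻¹ * fgComm fgA (fgB ^ m) * w) f =
      f + fun i => if i = e then (m : ℤ) else 0 := by
  obtain ⟨e, he⟩ := exists_seqAction_add w
  refine ⟨e, fun m f => ?_⟩
  have h := seqAction_fgComm 1 m (seqAction w f)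
  rw [pow_one] at h
  rw [map_mul, map_mul, map_inv, Equiv.Perm.mul_apply, Equiv.Perm.mul_apply, h,
    Equiv.Perm.inv_eq_iff_eq, he]
  congr 1
  funext i
  congr 1
  simp only [eq_iff_iff]
  omega

lemma List.prod_ofFn_perm_apply_of_translation {M : Type*} [AddCommMonoid M] {k : ℕ}
    (g : Fin k → Equiv.Perm M) (v : Fin k → M) (h : ∀ j f, g j f = f + v j) (f : M) :
    (List.ofFn g).prod f = f + ∑ j, v j := by
  induction k with
  | zero => simp
  | succ k ih =>
    rw [List.ofFn_succ, List.prod_cons, Equiv.Perm.mul_apply, h,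
      ih _ (fun j => v j.succ) fun j => h j.succ, Fin.sum_univ_succ, add_assoc,
      add_comm (v 0)]

/-- If the quadratic equation `∏ zⱼ⁻¹ [a, b^{nⱼ}] zⱼ = [a^N, b^B]` has a solution in the free
group on `a, b`, then `(n₁, …, n_k)` can be partitioned into `N` bins, each of sum `B`. -/
theorem quad_eq_solvable_implies_exact_bin_packing
    (k N B : ℕ) (hk : 0 < k) (hN : 0 < N) (hB : 0 < B)
    (n : Fin k → ℕ) (hn : ∀ j, 0 < n j)
    (z : Fin k → FreeGroup (Fin 2))
    (hz : (List.ofFn (fun j : Fin k => (z j)⁻¹ * fgComm fgA (fgB ^ n j) * z j)).prod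
        = fgComm (fgA ^ N) (fgB ^ B)) :
    ∃ S : Fin k → Fin N, ∀ i : Fin N,
      ∑ j ∈ Finset.univ.filter (fun j => S j = i), n j = B := by
  choose e he using fun j => exists_seqAction_conj_fgComm (z j)
  have key : ∀ i : ℤ, ∑ j, (if i = e j then (n j : ℤ) else 0) =
      if 0 ≤ i ∧ i < N then (B : ℤ) else 0 := by
    intro i
    have h := congrArg (fun w => seqAction w 0 i) hz
    simp only [map_list_prod, List.map_ofFn, seqAction_fgComm] at h
    rw [List.prod_ofFn_perm_apply_of_translation (seqAction ∘ _) _ fun j f => he j (n j) f] at h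
    simpa using h
  have hmem : ∀ j, 0 ≤ e j ∧ e j < N := by
    intro j
    by_contra hj
    have h := key (e j)
    rw [if_neg hj, Finset.sum_eq_zero_iff_of_nonneg fun x _ => by positivity] at h
    have := h j (Finset.mem_univ j)
    have := hn j
    simp at *
    omega
  refine ⟨fun j => ⟨(e j).toNat, by have := hmem j; omega⟩, fun i => ?_⟩
  have h := key i
  rw [if_pos (by omega)] at h
  rw [← Nat.cast_inj (R := ℤ), ← h, Finset.sum_filter, Nat.cast_sum]
  refine Finset.sum_congr rfl fun j _ => ?_
  have hj := hmem j
  simp only [Fin.ext_iff, Nat.cast_ite, Nat.cast_zero]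
  congr 1
  simp only [eq_iff_iff]
  omega
end

section
/- Let F be the free group on two generators a, b, and write [x,y] = x⁻¹y⁻¹xy. Fix positive integers k, N, B and positive integers n₁,…,n_k. If there exist z₁,…,z_k ∈ F with ∏_{j=1}^{k} z_j⁻¹ [a, b^{n_j}] z_j = [a^N, b^B], then ∑_{j=1}^{k} n_j = N·B. -/
/-- The integral Heisenberg group, in coordinates: `⟨x, y, z⟩` stands for the upper unitriangular
matrix with `x`, `y` above the diagonal and `z` in the corner. -/
@[ext]
structure Heisenberg where
  /-- The first coordinate. -/
  x : ℤ
  /-- The second coordinate. -/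
  y : ℤ
  /-- The central coordinate. -/
  z : ℤ

namespace Heisenberg

instance : Mul Heisenberg := ⟨fun g h => ⟨g.x + h.x, g.y + h.y, g.z + h.z + g.x * h.y⟩⟩

instance : One Heisenberg := ⟨⟨0, 0, 0⟩⟩

instance : Inv Heisenberg := ⟨fun g => ⟨-g.x, -g.y, -g.z + g.x * g.y⟩⟩

@[simp] theorem mul_x (g h : Heisenberg) : (g * h).x = g.x + h.x := rfl

@[simp] theorem mul_y (g h : Heisenberg) : (g * h).y = g.y + h.y := rfl

@[simp] theorem mul_z (g h : Heisenberg) : (g * h).z = g.z + h.z + g.x * h.y := rfl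

@[simp] theorem one_x : (1 : Heisenberg).x = 0 := rfl

@[simp] theorem one_y : (1 : Heisenberg).y = 0 := rfl

@[simp] theorem one_z : (1 : Heisenberg).z = 0 := rfl

@[simp] theorem inv_x (g : Heisenberg) : g⁻¹.x = -g.x := rfl

@[simp] theorem inv_y (g : Heisenberg) : g⁻¹.y = -g.y := rfl

@[simp] theorem inv_z (g : Heisenberg) : g⁻¹.z = -g.z + g.x * g.y := rfl

instance : Group Heisenberg :=
  Group.ofLeftAxioms
    (fun g h k => by ext <;> simp <;> ring)
    (fun g => by ext <;> simp)
    (fun g => by ext <;> simp)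

@[simp] theorem pow_x (g : Heisenberg) (n : ℕ) : (g ^ n).x = n * g.x := by
  induction n with
  | zero => simp
  | succ n ih => rw [pow_succ, mul_x, ih]; push_cast; ring

@[simp] theorem pow_y (g : Heisenberg) (n : ℕ) : (g ^ n).y = n * g.y := by
  induction n with
  | zero => simp
  | succ n ih => rw [pow_succ, mul_y, ih]; push_cast; ring

theorem commutator_eq (g h : Heisenberg) :
    g⁻¹ * h⁻¹ * g * h = ⟨0, 0, g.x * h.y - h.x * g.y⟩ := by
  ext
  · simp
  · simp
  · simp only [mul_z, inv_z, mul_x, inv_x, inv_y]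
    ring

theorem inv_mul_central_mul (g : Heisenberg) (c : ℤ) :
    g⁻¹ * ⟨0, 0, c⟩ * g = ⟨0, 0, c⟩ := by
  ext
  · simp
  · simp
  · simp only [mul_z, inv_z, mul_x, inv_x]
    ring

theorem prod_ofFn_central {k : ℕ} (c : Fin k → ℤ) :
    (List.ofFn fun j => (⟨0, 0, c j⟩ : Heisenberg)).prod = ⟨0, 0, ∑ j, c j⟩ := by
  induction k with
  | zero => rfl
  | succ k ih =>
    rw [List.ofFn_succ, List.prod_cons, ih fun j => c j.succ, Fin.sum_univ_succ]
    ext <;> simp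

end Heisenberg

/-- The homomorphism to the Heisenberg group sending the two generators to `⟨1, 0, 0⟩` and
`⟨0, 1, 0⟩`. -/
def toHeisenberg : FreeGroup (Fin 2) →* Heisenberg :=
  FreeGroup.lift ![⟨1, 0, 0⟩, ⟨0, 1, 0⟩]

theorem toHeisenberg_fgComm_pow (m n : ℕ) :
    toHeisenberg (fgComm (fgA ^ m) (fgB ^ n)) = ⟨0, 0, m * n⟩ := by
  simp only [fgComm, map_mul, map_inv, Heisenberg.commutator_eq]
  simp [toHeisenberg, fgA, fgB]

/-- If the quadratic equation `∏ zⱼ⁻¹ [a, b^{nⱼ}] zⱼ = [a^N, b^B]` has a solution in the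
free group on `a, b`, then `∑ nⱼ = N·B`. -/
theorem quad_eq_solvable_implies_total_sum
    (k N B : ℕ) (hk : 0 < k) (hN : 0 < N) (hB : 0 < B)
    (n : Fin k → ℕ) (hn : ∀ j, 0 < n j)
    (z : Fin k → FreeGroup (Fin 2))
    (hz : (List.ofFn (fun j : Fin k => (z j)⁻¹ * fgComm fgA (fgB ^ n j) * z j)).prod
        = fgComm (fgA ^ N) (fgB ^ B)) :
    ∑ j, n j = N * B := by
  have h := congrArg toHeisenberg hz
  have hc (j : Fin k) : toHeisenberg ((z j)⁻¹ * fgComm fgA (fgB ^ n j) * z j) = ⟨0, 0, n j⟩ := by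
    have := toHeisenberg_fgComm_pow 1 (n j)
    rw [pow_one] at this
    rw [map_mul, map_mul, map_inv, this, Heisenberg.inv_mul_central_mul]
    simp
  rw [map_list_prod, List.map_ofFn, toHeisenberg_fgComm_pow] at h
  simp only [Function.comp_def, hc, Heisenberg.prod_ofFn_central] at h
  have hsum : ∑ j, (n j : ℤ) = N * B := congrArg Heisenberg.z h
  exact_mod_cast hsum
end
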